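/- Let m > 1 and let F₀ ∈ C^∞([0,∞)) be sublinear with 0 ≤ F₀(x) ≤ m·x for all x ≥ 0. Then there does NOT exist a function F ∈ C¹([0,∞)×[0,∞)) which is sublinear in x, satisfies 0 ≤ F(x,t) ≤ m·x for all x,t ≥ 0, F(x,0) = F₀(x) for all x ≥ 0, and satisfies ∂_t F + (1/2)(∂_x F − m)(∂_x F − m − 1) + F/x − m = 0 pointwise on (0,∞)×(0,∞). -/

import Mathlib

open Set Filter

/-- A function `ψ : [0,∞) → ℝ` is sublinear if `ψ(x)/x → 0` as `x → ∞`. -/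
def Sublinear (ψ : ℝ → ℝ) : Prop :=
  Tendsto (fun x => ψ x / x) atTop (nhds 0)

/-- `F` is sublinear in `x` if `x ↦ F(x,t)` is sublinear for each `t ≥ 0`. -/
def SublinearInX (F : ℝ → ℝ → ℝ) : Prop :=
  ∀ t, 0 ≤ t → Sublinear (fun x => F x t)

/-- Partial derivatives and the derivative along the characteristic direction `(-c, 1)` at a point
where a function of two variables is differentiable. -/
lemma HasFDerivAt.hasDerivAt_characteristic {F : ℝ → ℝ → ℝ} {L : ℝ × ℝ →L[ℝ] ℝ} {x c s : ℝ}
    (hL : HasFDerivAt (fun p : ℝ × ℝ => F p.1 p.2) L (x - c * s, s)) :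
    HasDerivAt (fun r => F (x - c * r) r)
      (deriv (fun r => F (x - c * s) r) s - c * deriv (fun y => F y s) (x - c * s)) s := by
  have ht : HasDerivAt (fun r => F (x - c * s) r) (L (0, 1)) s :=
    hL.comp_hasDerivAt (f := fun r : ℝ => (x - c * s, r)) s
      ((hasDerivAt_const s (x - c * s)).prodMk (hasDerivAt_id s))
  have hx : HasDerivAt (fun y => F y s) (L (1, 0)) (x - c * s) :=
    hL.comp_hasDerivAt (f := fun y : ℝ => (y, s)) (x - c * s)
      ((hasDerivAt_id (x - c * s)).prodMk (hasDerivAt_const (x - c * s) s))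
  have hline : HasDerivAt (fun r : ℝ => (x - c * r, r)) (-(c * 1), (1 : ℝ)) s :=
    (((hasDerivAt_id s).const_mul c).const_sub x).prodMk (hasDerivAt_id s)
  have hdir : HasDerivAt (fun r => F (x - c * r) r) (L (-(c * 1), 1)) s :=
    hL.comp_hasDerivAt (f := fun r : ℝ => (x - c * r, r)) s hline
  have hsplit : ((-(c * 1), 1) : ℝ × ℝ) = (0, 1) - c • (1, 0) := by
    ext <;> simp
  rwa [hsplit, map_sub, map_smul, smul_eq_mul, ← ht.deriv, ← hx.deriv] at hdir

/-- A nonnegative `C¹` solution has initial data growing at least linearly: the Hamiltonian lies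
above its tangent line at `0`, so the solution decreases at rate at least `m * (m - 1) / 2` along
the lines of slope `-(m + 1 / 2)`, each of which reaches `x = 0`. -/
lemma linear_lower_bound_of_solution {m : ℝ} (hm : 1 < m) {F : ℝ → ℝ → ℝ}
    (hF : ContDiffOn ℝ 1 (fun p : ℝ × ℝ => F p.1 p.2) (Ici 0 ×ˢ Ici 0))
    (hnonneg : ∀ x t : ℝ, 0 ≤ x → 0 ≤ t → 0 ≤ F x t)
    (hpde : ∀ x t : ℝ, 0 < x → 0 < t →
      deriv (fun s => F x s) t +
        (1 / 2) * (deriv (fun y => F y t) x - m) * (deriv (fun y => F y t) x - m - 1) +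
        F x t / x - m = 0)
    {x : ℝ} (hx : 0 < x) :
    m * (m - 1) / 2 * (x / (m + 1 / 2)) ≤ F x 0 := by
  set c : ℝ := m + 1 / 2 with hc
  have hcpos : 0 < c := by linarith
  have hT : 0 < x / c := div_pos hx hcpos
  have hderiv : ∀ s ∈ Ioo 0 (x / c), HasDerivAt (fun r => F (x - c * r) r)
      (deriv (fun r => F (x - c * s) r) s - c * deriv (fun y => F y s) (x - c * s)) s := by
    intro s hs
    have hpos : 0 < x - c * s := by
      have := (lt_div_iff₀' hcpos).1 hs.2
      linarith
    have hnhds : (Ici 0 ×ˢ Ici 0 : Set (ℝ × ℝ)) ∈ nhds (x - c * s, s) :=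
      prod_mem_nhds (Ici_mem_nhds hpos) (Ici_mem_nhds hs.1)
    exact ((hF.contDiffAt hnhds).differentiableAt one_ne_zero).hasFDerivAt.hasDerivAt_characteristic
  have hcont : ContinuousOn (fun r => F (x - c * r) r) (Icc 0 (x / c)) := by
    refine hF.continuousOn.comp (f := fun r : ℝ => (x - c * r, r)) (by fun_prop) ?_
    intro s hs
    have := (le_div_iff₀' hcpos).1 hs.2
    exact ⟨by simpa using this, hs.1⟩
  have hmvt := (convex_Icc 0 (x / c)).image_sub_le_mul_sub_of_deriv_le (C := -(m * (m - 1) / 2))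
    hcont
    (by
      rw [interior_Icc]
      exact fun s hs => (hderiv s hs).differentiableAt.differentiableWithinAt)
    (by
      rw [interior_Icc]
      intro s hs
      have hpos : 0 < x - c * s := by
        have := (lt_div_iff₀' hcpos).1 hs.2
        linarith
      rw [(hderiv s hs).deriv]
      have hquot : 0 ≤ F (x - c * s) s / (x - c * s) :=
        div_nonneg (hnonneg _ _ hpos.le hs.1.le) hpos.le
      have heq := hpde _ _ hpos hs.1
      generalize deriv (fun y => F y s) (x - c * s) = p at heq ⊢
      have hcp : c * p = (m + 1 / 2) * p := congrArg (· * p) hc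
      nlinarith [sq_nonneg p])
    0 (left_mem_Icc.2 hT.le) (x / c) (right_mem_Icc.2 hT.le) hT.le
  have hend : x - c * (x / c) = 0 := by field_simp; ring
  simp only [hend, mul_zero, sub_zero] at hmvt
  linarith [hnonneg 0 (x / c) le_rfl hT.le]

/-- Theorem 1.3, no `C¹` sublinear solutions when `m > 1`.
For `m > 1` and `F₀` smooth, sublinear with `0 ≤ F₀(x) ≤ m·x`, there is no sublinear-in-`x`
function `F ∈ C¹([0,∞)×[0,∞))` with `0 ≤ F(x,t) ≤ m·x`, `F(x,0) = F₀(x)`, solving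
`∂ₜF + (1/2)(∂ₓF − m)(∂ₓF − m − 1) + F/x − m = 0` pointwise on `(0,∞)×(0,∞)`. -/
theorem no_C1_sublinear_solution (m : ℝ) (hm : 1 < m)
    (F₀ : ℝ → ℝ)
    (hF₀_smooth : ContDiffOn ℝ (⊤ : ℕ∞) F₀ (Ici 0))
    (hF₀_sub : Sublinear F₀)
    (hF₀_bd : ∀ x : ℝ, 0 ≤ x → 0 ≤ F₀ x ∧ F₀ x ≤ m * x) :
    ¬ ∃ F : ℝ → ℝ → ℝ,
        ContDiffOn ℝ 1 (fun p : ℝ × ℝ => F p.1 p.2) (Ici 0 ×ˢ Ici 0) ∧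
        SublinearInX F ∧
        (∀ x t : ℝ, 0 ≤ x → 0 ≤ t → 0 ≤ F x t ∧ F x t ≤ m * x) ∧
        (∀ x : ℝ, 0 ≤ x → F x 0 = F₀ x) ∧
        (∀ x t : ℝ, 0 < x → 0 < t →
          deriv (fun s => F x s) t +
            (1 / 2) * (deriv (fun y => F y t) x - m) * (deriv (fun y => F y t) x - m - 1) +
            F x t / x - m = 0) := by
  rintro ⟨F, hF, -, hbd, hinit, hpde⟩
  have hrate : 0 < m * (m - 1) / 2 / (m + 1 / 2) := by
    have : 0 < m - 1 := by linarith
    positivity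
  obtain ⟨x, hlt, hx⟩ :=
    ((hF₀_sub.eventually (gt_mem_nhds hrate)).and (eventually_gt_atTop 0)).exists
  have hle := linear_lower_bound_of_solution hm hF (fun x t hx ht => (hbd x t hx ht).1) hpde hx
  rw [hinit x hx.le] at hle
  rw [div_lt_iff₀ hx] at hlt
  have : m * (m - 1) / 2 * (x / (m + 1 / 2)) = m * (m - 1) / 2 / (m + 1 / 2) * x := by ring
  linarith
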